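/- arXiv:1204.1690 — 5 statements merged into one kernel-verified Lean document; each statement's English description precedes it below -/
import Mathlib

section
/- Let E be a finite-dimensional real normed vector space, X : E → E a C^∞ vector field, and f : E → ℝ a C^∞ function such that df_p(X_p) = 0 for every p ∈ E. Then for any C^∞ functions u, v : ℝ → ℝ, the Lie bracket of the vector fields p ↦ u(f(p))·X_p and p ↦ v(f(p))·X_p vanishes identically. -/
/-- If the derivative of `f` vanishes in the direction `w`, then so does that of `g ∘ f`, so `g ∘ f`
can be pulled out of the derivative of `(g ∘ f) • Y` in the direction `w`. -/
theorem fderiv_comp_smul_apply_of_fderiv_apply_eq_zero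
    {E F : Type*} [NormedAddCommGroup E] [NormedSpace ℝ E]
    [NormedAddCommGroup F] [NormedSpace ℝ F]
    {Y : E → F} {f : E → ℝ} {g : ℝ → ℝ} {p w : E}
    (hY : DifferentiableAt ℝ Y p) (hf : DifferentiableAt ℝ f p)
    (hg : DifferentiableAt ℝ g (f p)) (hw : fderiv ℝ f p w = 0) :
    fderiv ℝ (fun q => g (f q) • Y q) p w = g (f p) • fderiv ℝ Y p w := by
  have h := (hg.hasDerivAt.comp_hasFDerivAt p hf.hasFDerivAt).smul hY.hasFDerivAt
  have h' : HasFDerivAt (fun q => g (f q) • Y q) _ p := h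
  simp [h'.fderiv, hw]

/-- If `X` is a `C^∞` vector field on a finite-dimensional real normed
vector space `E` and `f : E → ℝ` is a `C^∞` function with `df_p(X_p) = 0` for every `p`,
then for any `C^∞` functions `u v : ℝ → ℝ` the Lie bracket
`[V, W]_p = DW_p(V_p) − DV_p(W_p)` of the vector fields `p ↦ u(f p) • X p` and
`p ↦ v(f p) • X p` vanishes identically. -/
theorem lie_bracket_of_rescaled_fields_eq_zero
    {E : Type*} [NormedAddCommGroup E] [NormedSpace ℝ E] [FiniteDimensional ℝ E]
    (X : E → E) (hX : ContDiff ℝ (⊤ : ℕ∞) X)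
    (f : E → ℝ) (hf : ContDiff ℝ (⊤ : ℕ∞) f)
    (hXf : ∀ p : E, fderiv ℝ f p (X p) = 0)
    (u v : ℝ → ℝ) (hu : ContDiff ℝ (⊤ : ℕ∞) u) (hv : ContDiff ℝ (⊤ : ℕ∞) v) :
    ∀ p : E,
      fderiv ℝ (fun q => v (f q) • X q) p (u (f p) • X p) -
        fderiv ℝ (fun q => u (f q) • X q) p (v (f p) • X p) = 0 := by
  intro p
  have hXp := hX.differentiable (by simp) p
  have hfp := hf.differentiable (by simp) p
  rw [map_smul, map_smul,
    fderiv_comp_smul_apply_of_fderiv_apply_eq_zero hXp hfp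
      (hv.differentiable (by simp) (f p)) (hXf p),
    fderiv_comp_smul_apply_of_fderiv_apply_eq_zero hXp hfp
      (hu.differentiable (by simp) (f p)) (hXf p),
    smul_comm, sub_self]
end

section
/- Fix an integer n ≥ 2 and t ∈ ℝ, and let c_{ij} be the functions with c_{ij}(t)·c_{jk}(t) = c_{ik}(t) for i ≤ j ≤ k defined by c_{ij}(t) = 1 for t ≤ 0, c_{ij}(t) = exp(−(j−i)t/(1−t)) for 0 < t < 1, and c_{ij}(t) = 0 for t ≥ 1 (i < j). Define a linear map θ_t on n × n real matrices by (θ_t A)_{ij} = c_{ij}(t)·A_{ij} for i < j and (θ_t A)_{ij} = 0 otherwise. Then for all strictly upper triangular matrices A, B (i.e. A_{ij} = 0 unless i < j), θ_t([A, B]) = [θ_t A, θ_t B], where [A, B] = AB − BA; that is, θ_t is a Lie algebra endomorphism of the Lie algebra of strictly upper triangular n × n real matrices. -/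
/-- The functions `c_{ij}` from Hirsch's construction: `c i j t = 1` for `t ≤ 0`,
`c i j t = exp (−(j−i)·t/(1−t))` for `0 < t < 1`, and (when `i < j`) `c i j t = 0`
for `t ≥ 1`, with `c i i ≡ 1`.  They satisfy `c i j t * c j k t = c i k t` for
`i ≤ j ≤ k`. -/
noncomputable def hirschC (i j : ℤ) (t : ℝ) : ℝ :=
  if t ≤ 0 then 1
  else if t < 1 then Real.exp (-((j : ℝ) - (i : ℝ)) * t / (1 - t))
  else if i < j then 0 else 1

theorem hirschC_mul_hirschC {i j k : ℤ} (hij : i < j) (hjk : j < k) (t : ℝ) :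
    hirschC i j t * hirschC j k t = hirschC i k t := by
  have hik := hij.trans hjk
  unfold hirschC
  split_ifs
  · simp
  · rw [← Real.exp_add]
    ring_nf
  · simp

/-- On strictly upper triangular matrices, rescaling the `(i, j)` entry by `c i j t` is
compatible with matrix multiplication. -/
theorem hirschC_scale_mul {n : ℕ} (t : ℝ) {A B : Matrix (Fin n) (Fin n) ℝ}
    (hA : ∀ i j : Fin n, ¬ i < j → A i j = 0) (hB : ∀ i j : Fin n, ¬ i < j → B i j = 0)
    (i k : Fin n) :
    (if i < k then hirschC ((i : ℕ) : ℤ) ((k : ℕ) : ℤ) t * (A * B) i k else 0) =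
      ∑ j : Fin n, (if i < j then hirschC ((i : ℕ) : ℤ) ((j : ℕ) : ℤ) t * A i j else 0) *
        (if j < k then hirschC ((j : ℕ) : ℤ) ((k : ℕ) : ℤ) t * B j k else 0) := by
  rw [Matrix.mul_apply, Finset.mul_sum,
    ← Finset.sum_const_zero (ι := Fin n) (s := Finset.univ), ← Finset.sum_ite_irrel]
  refine Finset.sum_congr rfl fun j _ => ?_
  by_cases hij : i < j
  · by_cases hjk : j < k
    · have h := hirschC_mul_hirschC (i := ((i : ℕ) : ℤ)) (j := ((j : ℕ) : ℤ))
        (k := ((k : ℕ) : ℤ)) (by exact_mod_cast hij) (by exact_mod_cast hjk) t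
      rw [if_pos (hij.trans hjk), if_pos hij, if_pos hjk, ← h]
      ring
    · simp [hjk, hB j k hjk]
  · simp [hij, hA i j hij]

/-- Fix `n ≥ 2` and `t : ℝ`, and let `θ_t` be the linear map on `n × n`
real matrices given by `(θ_t A)_{ij} = c_{ij}(t) · A_{ij}` for `i < j` and `0` otherwise.
Then for all strictly upper triangular `A`, `B` one has `θ_t [A,B] = [θ_t A, θ_t B]`
where `[A,B] = AB − BA`; i.e. `θ_t` is a Lie algebra endomorphism of the Lie algebra of
strictly upper triangular `n × n` real matrices. -/
theorem hirsch_theta_bracket (n : ℕ) (hn : 2 ≤ n) (t : ℝ)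
    (θ : Matrix (Fin n) (Fin n) ℝ → Matrix (Fin n) (Fin n) ℝ)
    (hθ : ∀ A : Matrix (Fin n) (Fin n) ℝ,
      θ A = Matrix.of fun i j : Fin n =>
        if i < j then hirschC ((i : ℕ) : ℤ) ((j : ℕ) : ℤ) t * A i j else 0)
    (A B : Matrix (Fin n) (Fin n) ℝ)
    (hA : ∀ i j : Fin n, ¬ i < j → A i j = 0)
    (hB : ∀ i j : Fin n, ¬ i < j → B i j = 0) :
    θ (A * B - B * A) = θ A * θ B - θ B * θ A := by
  ext i k
  have hAB := hirschC_scale_mul t hA hB i k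
  have hBA := hirschC_scale_mul t hB hA i k
  simp only [hθ, Matrix.of_apply, Matrix.sub_apply, Matrix.mul_apply (M := Matrix.of _)]
  rw [← hAB, ← hBA]
  split_ifs <;> ring
end

section
/- For every n ≥ 2, the real Lie algebra 𝔫 of strictly upper triangular n × n real matrices (with bracket [A,B] = AB − BA) is Lie contractible: there exists a family θ_t (t ∈ ℝ) of Lie algebra endomorphisms of 𝔫 such that θ_t is the identity for t ≤ 0, θ_t = 0 for t ≥ 1, and the map ℝ × 𝔫 → 𝔫, (t, A) ↦ θ_t(A), is C^∞. -/
/-- Scaling of the `(j - i)`-th superdiagonal of a matrix by `s ^ (j - i)`. -/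
def superdiagonalScale (n : ℕ) (s : ℝ) : (Fin n → Fin n → ℝ) →ₗ[ℝ] (Fin n → Fin n → ℝ) where
  toFun A i j := s ^ ((j : ℕ) - (i : ℕ)) * A i j
  map_add' A B := by ext i j; simp [mul_add]
  map_smul' c A := by ext i j; simp [mul_left_comm]

lemma superdiagonalScale_apply {n : ℕ} (s : ℝ) (A : Fin n → Fin n → ℝ) (i j : Fin n) :
    superdiagonalScale n s A i j = s ^ ((j : ℕ) - (i : ℕ)) * A i j := rfl

/-- Scaling of superdiagonals is multiplicative on strictly upper triangular matrices. -/
lemma superdiagonalScale_mul {n : ℕ} (s : ℝ) {A B : Fin n → Fin n → ℝ}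
    (hA : ∀ i j : Fin n, ¬ i < j → A i j = 0) (hB : ∀ i j : Fin n, ¬ i < j → B i j = 0)
    (i j : Fin n) :
    (Matrix.of (superdiagonalScale n s A) * Matrix.of (superdiagonalScale n s B)) i j =
      s ^ ((j : ℕ) - (i : ℕ)) * (Matrix.of A * Matrix.of B) i j := by
  simp only [Matrix.mul_apply, Matrix.of_apply, superdiagonalScale_apply, Finset.mul_sum]
  refine Finset.sum_congr rfl fun k _ => ?_
  by_cases hik : i < k
  · by_cases hkj : k < j
    · have h : (j : ℕ) - (i : ℕ) = ((k : ℕ) - (i : ℕ)) + ((j : ℕ) - (k : ℕ)) := by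
        have := Fin.lt_def.1 hik
        have := Fin.lt_def.1 hkj
        omega
      rw [h, pow_add]
      ring
    · simp [hB k j hkj]
  · simp [hA i k hik]

lemma contDiff_superdiagonalScale {n : ℕ} {E : Type*} [NormedAddCommGroup E] [NormedSpace ℝ E]
    {m : WithTop ℕ∞} {f : E → ℝ} {g : E → Fin n → Fin n → ℝ}
    (hf : ContDiff ℝ m f) (hg : ContDiff ℝ m g) :
    ContDiff ℝ m fun x => superdiagonalScale n (f x) (g x) :=
  contDiff_pi.2 fun i => contDiff_pi.2 fun j =>
    (hf.pow _).mul (contDiff_pi.1 (contDiff_pi.1 hg i) j)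

/-- A map into a subspace of a finite-dimensional space is smooth when it is smooth as a map into
the ambient space. -/
lemma Submodule.contDiff_of_contDiff_coe {E F : Type*} [NormedAddCommGroup E] [NormedSpace ℝ E]
    [NormedAddCommGroup F] [NormedSpace ℝ F] [FiniteDimensional ℝ F] {m : WithTop ℕ∞}
    (p : Submodule ℝ F) {f : E → p} (hf : ContDiff ℝ m fun x => (f x : F)) :
    ContDiff ℝ m f := by
  obtain ⟨π, hπ⟩ := p.subtype.exists_leftInverse_of_injective p.ker_subtype
  have h : f = fun x => LinearMap.toContinuousLinearMap π (f x : F) :=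
    funext fun x => (LinearMap.congr_fun hπ (f x)).symm
  rw [h]
  exact (LinearMap.toContinuousLinearMap π).contDiff.comp hf

/-- For every `n ≥ 2` the real Lie algebra `𝔫` of strictly upper
triangular `n × n` real matrices (with bracket `[A,B] = AB − BA`) is Lie contractible:
there is a family `θ t` of Lie algebra endomorphisms of `𝔫` (linear maps preserving the
commutator bracket) with `θ t = id` for `t ≤ 0`, `θ t = 0` for `t ≥ 1`, and
`(t, A) ↦ θ t A` of class `C^∞` on `ℝ × 𝔫`.

Here `𝔫` is encoded as the submodule of `Fin n → Fin n → ℝ` (the space of `n × n`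
matrices) consisting of the strictly upper triangular matrices, and bracket preservation
is stated via the commutator of the corresponding matrices. -/
theorem strictlyUpperTriangular_lieContractible (n : ℕ) (hn : 2 ≤ n)
    (𝔫 : Submodule ℝ (Fin n → Fin n → ℝ))
    (h𝔫 : ∀ A : Fin n → Fin n → ℝ, A ∈ 𝔫 ↔ ∀ i j : Fin n, ¬ i < j → A i j = 0) :
    ∃ θ : ℝ → (𝔫 →ₗ[ℝ] 𝔫),
      (∀ t : ℝ, t ≤ 0 → θ t = LinearMap.id) ∧
      (∀ t : ℝ, 1 ≤ t → θ t = 0) ∧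
      (∀ (t : ℝ) (A B C : 𝔫),
        Matrix.of (C : Fin n → Fin n → ℝ) =
            Matrix.of (A : Fin n → Fin n → ℝ) * Matrix.of (B : Fin n → Fin n → ℝ) -
              Matrix.of (B : Fin n → Fin n → ℝ) * Matrix.of (A : Fin n → Fin n → ℝ) →
        Matrix.of ((θ t C : 𝔫) : Fin n → Fin n → ℝ) =
            Matrix.of ((θ t A : 𝔫) : Fin n → Fin n → ℝ) *
                Matrix.of ((θ t B : 𝔫) : Fin n → Fin n → ℝ) -
              Matrix.of ((θ t B : 𝔫) : Fin n → Fin n → ℝ) *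
                Matrix.of ((θ t A : 𝔫) : Fin n → Fin n → ℝ)) ∧
      ContDiff ℝ (⊤ : ℕ∞) fun p : ℝ × 𝔫 => (θ p.1 p.2 : 𝔫) := by
  have hmem (s : ℝ) (A : Fin n → Fin n → ℝ) (hA : A ∈ 𝔫) : superdiagonalScale n s A ∈ 𝔫 :=
    (h𝔫 _).2 fun i j hij => by simp [superdiagonalScale_apply, (h𝔫 A).1 hA i j hij]
  refine ⟨fun t => (superdiagonalScale n (Real.smoothTransition (1 - t))).restrict (hmem _),
    fun t ht => ?_, fun t ht => ?_, fun t A B C hC => ?_, ?_⟩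
  · ext A i j
    simp [superdiagonalScale_apply, Real.smoothTransition.one_of_one_le (by linarith : 1 ≤ 1 - t)]
  · ext A i j
    by_cases hij : i < j
    · have h : (j : ℕ) - (i : ℕ) ≠ 0 := Nat.sub_ne_zero_of_lt hij
      simp [superdiagonalScale_apply,
        Real.smoothTransition.zero_of_nonpos (by linarith : 1 - t ≤ 0), h]
    · simp [superdiagonalScale_apply, (h𝔫 A).1 A.2 i j hij]
  · have hA := (h𝔫 A).1 A.2
    have hB := (h𝔫 B).1 B.2
    ext i j
    have hCij := congrFun (congrFun hC i) j
    simp only [Matrix.sub_apply, Matrix.of_apply] at hCij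
    simp only [LinearMap.coe_restrict_apply, Matrix.sub_apply, superdiagonalScale_mul _ hA hB,
      superdiagonalScale_mul _ hB hA, Matrix.of_apply, superdiagonalScale_apply, hCij, mul_sub]
  · exact 𝔫.contDiff_of_contDiff_coe <| contDiff_superdiagonalScale
      (Real.smoothTransition.contDiff.comp (contDiff_const.sub contDiff_fst))
      (𝔫.subtypeL.contDiff.comp contDiff_snd)
end

section
/- Let 𝔤 be a finite-dimensional real Lie algebra and 𝔥 ⊆ 𝔤 a Lie subalgebra. Let θ be a deformation of 𝔤 which retracts 𝔤 into 𝔥, i.e. θ_1(𝔤) ⊆ 𝔥 and θ_t(𝔥) ⊆ 𝔥 for all t ∈ ℝ, and let ψ be a Lie contraction of 𝔥. Then the concatenation (ψ#θ)_t, defined by (ψ#θ)_t = θ_{2t} for t ≤ 1/2 and (ψ#θ)_t = ψ_{2t−1} ∘ θ_1 for t ≥ 1/2, is a Lie contraction of 𝔤. -/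
/-- Let `𝔤` be a finite-dimensional real Lie algebra (encoded as a
finite-dimensional real normed space `L` with a bilinear bracket `br` satisfying
`br x x = 0` and the Jacobi identity) and `𝔥 ⊆ 𝔤` a Lie subalgebra (a submodule closed
under the bracket).  Let `θ` be a deformation of `𝔤` (a `C^∞` family of Lie algebra
endomorphisms, equal to the identity for `t ≤ 0` and to `θ 1` for `t ≥ 1`) which
retracts `𝔤` into `𝔥`, and let `ψ` be a Lie contraction of `𝔥`.  Then the concatenation
`(ψ#θ)_t`, given by `θ (2t)` for `t ≤ 1/2` and `ψ (2t−1) ∘ θ 1` for `t ≥ 1/2`, is a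
Lie contraction of `𝔤`. -/
theorem concat_lieContraction
    {L : Type*} [NormedAddCommGroup L] [NormedSpace ℝ L] [FiniteDimensional ℝ L]
    (br : L →ₗ[ℝ] L →ₗ[ℝ] L)
    (hskew : ∀ x : L, br x x = 0)
    (hjacobi : ∀ x y z : L, br x (br y z) = br (br x y) z + br y (br x z))
    (𝔥 : Submodule ℝ L)
    (hcl : ∀ x ∈ 𝔥, ∀ y ∈ 𝔥, br x y ∈ 𝔥)
    -- `θ` is a deformation of `𝔤`:
    (θ : ℝ → (L →ₗ[ℝ] L))
    (hθbr : ∀ (t : ℝ) (x y : L), θ t (br x y) = br (θ t x) (θ t y))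
    (hθ0 : ∀ t : ℝ, t ≤ 0 → θ t = LinearMap.id)
    (hθ1 : ∀ t : ℝ, 1 ≤ t → θ t = θ 1)
    (hθsm : ContDiff ℝ (⊤ : ℕ∞) fun p : ℝ × L => θ p.1 p.2)
    -- `θ` retracts `𝔤` into `𝔥`:
    (hret1 : ∀ x : L, θ 1 x ∈ 𝔥)
    (hret : ∀ t : ℝ, ∀ x ∈ 𝔥, θ t x ∈ 𝔥)
    -- `ψ` is a Lie contraction of `𝔥`:
    (ψ : ℝ → (𝔥 →ₗ[ℝ] 𝔥))
    (hψbr : ∀ (t : ℝ) (x y : 𝔥),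
      (ψ t ⟨br (x : L) (y : L), hcl (x : L) x.2 (y : L) y.2⟩ : L) =
        br ((ψ t x : 𝔥) : L) ((ψ t y : 𝔥) : L))
    (hψ0 : ∀ t : ℝ, t ≤ 0 → ψ t = LinearMap.id)
    (hψ1 : ∀ t : ℝ, 1 ≤ t → ψ t = 0)
    (hψsm : ContDiff ℝ (⊤ : ℕ∞) fun p : ℝ × 𝔥 => (ψ p.1 p.2 : 𝔥)) :
    -- the concatenation `χ = ψ#θ` is a Lie contraction of `𝔤`:
    ∀ χ : ℝ → L → L,
      (∀ (t : ℝ) (x : L),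
        χ t x = if t ≤ 1 / 2 then θ (2 * t) x else (ψ (2 * t - 1) ⟨θ 1 x, hret1 x⟩ : L)) →
      (∀ t : ℝ, IsLinearMap ℝ (χ t)) ∧
      (∀ (t : ℝ) (x y : L), χ t (br x y) = br (χ t x) (χ t y)) ∧
      (∀ t : ℝ, t ≤ 0 → ∀ x : L, χ t x = x) ∧
      (∀ t : ℝ, 1 ≤ t → ∀ x : L, χ t x = 0) ∧
      ContDiff ℝ (⊤ : ℕ∞) fun p : ℝ × L => χ p.1 p.2 := by
  intro χ hχ
  let r : L →ₗ[ℝ] 𝔥 := (θ 1).codRestrict 𝔥 hret1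
  have hr : ∀ x, (⟨θ 1 x, hret1 x⟩ : 𝔥) = r x := fun _ => rfl
  have hrL : ∀ x, ((r x : 𝔥) : L) = θ 1 x := fun _ => rfl
  refine ⟨fun t => ?_, fun t x y => ?_, fun t ht x => ?_, fun t ht x => ?_, ?_⟩
  · constructor <;> intros <;> simp only [hχ, hr] <;> split_ifs <;> simp
  · simp only [hχ]
    split_ifs
    · exact hθbr _ _ _
    · rw [← hψbr]
      simp only [hθbr]
  · rw [hχ, if_pos (by linarith), hθ0 _ (by linarith), LinearMap.id_apply]
  · rw [hχ, if_neg (by linarith), hψ1 _ (by linarith)]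
    simp
  · -- Both branches are restrictions of the globally smooth `θ (2t) + (ψ (2t-1) ∘ θ 1 - θ 1)`.
    have key : (fun p : ℝ × L => χ p.1 p.2) = fun p : ℝ × L =>
        θ (2 * p.1) p.2 + ((ψ (2 * p.1 - 1) (r p.2) : L) - θ 1 p.2) := by
      funext ⟨t, x⟩
      simp only [hχ, hr]
      split_ifs with h
      · rw [hψ0 _ (by linarith), LinearMap.id_apply, hrL, sub_self, add_zero]
      · rw [hθ1 (2 * t) (by linarith)]
        abel
    have hr_smooth : ContDiff ℝ (⊤ : ℕ∞) r := r.toContinuousLinearMap.contDiff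
    have hθ1_smooth : ContDiff ℝ (⊤ : ℕ∞) (θ 1) := (θ 1).toContinuousLinearMap.contDiff
    have hfst : ContDiff ℝ (⊤ : ℕ∞) fun p : ℝ × L => 2 * p.1 := contDiff_const.mul contDiff_fst
    have hψr : ContDiff ℝ (⊤ : ℕ∞) fun p : ℝ × L => ψ (2 * p.1 - 1) (r p.2) :=
      hψsm.comp ((hfst.sub contDiff_const).prodMk (hr_smooth.comp contDiff_snd))
    rw [key]
    exact (hθsm.comp (hfst.prodMk contDiff_snd)).add
      ((𝔥.subtypeL.contDiff.comp hψr).sub (hθ1_smooth.comp contDiff_snd))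
end

section
/- Every finite-dimensional real Lie algebra that is Lie contractible is solvable. -/
open LieAlgebra in
/-- The derived series of the preimage of an ideal maps into the derived series of the ideal. -/
theorem LieIdeal.derivedSeriesOfIdeal_comap_le {R L S : Type*} [CommRing R] [LieRing L]
    [LieAlgebra R L] [LieRing S] [LieAlgebra R S] (f : L →ₗ⁅R⁆ S) (J : LieIdeal R S) (k : ℕ) :
    derivedSeriesOfIdeal R L k (J.comap f) ≤ (derivedSeriesOfIdeal R S k J).comap f := by
  induction k with
  | zero => exact le_rfl
  | succ k ih =>
    rw [derivedSeriesOfIdeal_succ, derivedSeriesOfIdeal_succ]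
    exact (LieSubmodule.mono_lie ih ih).trans (LieIdeal.comap_bracket_le f)

open LieAlgebra in
/-- Surjective homomorphisms commute with the derived series of an ideal. -/
theorem LieIdeal.map_derivedSeriesOfIdeal {R L S : Type*} [CommRing R] [LieRing L]
    [LieAlgebra R L] [LieRing S] [LieAlgebra R S] (f : L →ₗ⁅R⁆ S) (hf : Function.Surjective f)
    (I : LieIdeal R L) (k : ℕ) :
    (derivedSeriesOfIdeal R L k I).map f = derivedSeriesOfIdeal R S k (I.map f) := by
  induction k with
  | zero => rfl
  | succ k ih =>
    rw [derivedSeriesOfIdeal_succ, derivedSeriesOfIdeal_succ, LieIdeal.map_bracket_eq f hf, ih]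

/-- The projection of a Lie algebra onto its quotient by an ideal, as a Lie algebra
homomorphism. -/
def LieIdeal.quotientMk {R L : Type*} [CommRing R] [LieRing L] [LieAlgebra R L]
    (I : LieIdeal R L) : L →ₗ⁅R⁆ L ⧸ I :=
  { (LieSubmodule.Quotient.mk' I : L →ₗ[R] L ⧸ I) with
    map_lie' := fun {x y} => LieSubmodule.Quotient.mk_bracket I x y }

theorem LieIdeal.quotientMk_surjective {R L : Type*} [CommRing R] [LieRing L] [LieAlgebra R L]
    (I : LieIdeal R L) : Function.Surjective I.quotientMk :=
  LieSubmodule.Quotient.surjective_mk' I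

theorem LieIdeal.quotientMk_eq_zero {R L : Type*} [CommRing R] [LieRing L] [LieAlgebra R L]
    (I : LieIdeal R L) (x : L) : I.quotientMk x = 0 ↔ x ∈ I :=
  LieSubmodule.Quotient.mk_eq_zero I

open LieAlgebra in
/-- The quotient of a Lie algebra by its radical has trivial radical. -/
theorem LieAlgebra.hasTrivialRadical_quotient_radical {R L : Type*} [CommRing R] [LieRing L]
    [LieAlgebra R L] [IsNoetherian R L] : HasTrivialRadical R (L ⧸ radical R L) := by
  rw [hasTrivialRadical_iff_no_solvable_ideals]
  intro J hJ
  set f := (radical R L).quotientMk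
  obtain ⟨k, hk⟩ := IsSolvable.solvable R J
  rw [LieIdeal.derivedSeries_eq_bot_iff] at hk
  obtain ⟨l, hl⟩ := IsSolvable.solvable R (radical R L)
  rw [LieIdeal.derivedSeries_eq_bot_iff] at hl
  have h1 : derivedSeriesOfIdeal R L k (J.comap f) ≤ radical R L := by
    refine (LieIdeal.derivedSeriesOfIdeal_comap_le f J k).trans fun x hx => ?_
    rw [hk, LieIdeal.mem_comap, LieSubmodule.mem_bot] at hx
    exact ((radical R L).quotientMk_eq_zero x).mp hx
  have h2 : derivedSeriesOfIdeal R L (l + k) (J.comap f) = ⊥ := by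
    rw [derivedSeriesOfIdeal_add, eq_bot_iff, ← hl]
    exact derivedSeriesOfIdeal_mono h1 l
  have h3 : IsSolvable (J.comap f) :=
    IsSolvable.mk (R := R) ((LieIdeal.derivedSeries_eq_bot_iff _ _).mpr h2)
  rw [LieIdeal.solvable_iff_le_radical] at h3
  rw [eq_bot_iff]
  intro z hz
  obtain ⟨x, rfl⟩ := (radical R L).quotientMk_surjective z
  exact ((radical R L).quotientMk_eq_zero x).mpr (h3 (LieIdeal.mem_comap.mpr hz))

open LieAlgebra in
/-- A surjection onto a Lie algebra with trivial radical kills the radical. -/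
theorem LieHom.apply_eq_zero_of_mem_radical {R L S : Type*} [CommRing R] [LieRing L]
    [LieAlgebra R L] [IsNoetherian R L] [LieRing S] [LieAlgebra R S] [HasTrivialRadical R S]
    (g : L →ₗ⁅R⁆ S) (hg : Function.Surjective g) {x : L} (hx : x ∈ radical R L) : g x = 0 := by
  obtain ⟨l, hl⟩ := IsSolvable.solvable R (radical R L)
  rw [LieIdeal.derivedSeries_eq_bot_iff] at hl
  have h1 : derivedSeriesOfIdeal R S l ((radical R L).map g) = ⊥ := by
    rw [← LieIdeal.map_derivedSeriesOfIdeal g hg, hl]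
    simp
  have : IsSolvable ((radical R L).map g) :=
    IsSolvable.mk (R := R) ((LieIdeal.derivedSeries_eq_bot_iff _ _).mpr h1)
  have h2 : (radical R L).map g = ⊥ := HasTrivialRadical.eq_bot_of_isSolvable _
  have h3 : g x ∈ (radical R L).map g := LieIdeal.mem_map hx
  rwa [h2, LieSubmodule.mem_bot] at h3

open LieAlgebra in
/-- If `f` and `g` are surjections onto a finite-dimensional Lie algebra `S` and `g` kills the
kernel of `f`, then they induce the same bilinear form from the Killing form of `S`. -/
theorem LieHom.killingForm_apply_eq_of_ker_le {K L S : Type*} [Field K] [LieRing L]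
    [LieAlgebra K L] [LieRing S] [LieAlgebra K S] [FiniteDimensional K S]
    (f g : L →ₗ⁅K⁆ S) (hf : Function.Surjective f) (hg : Function.Surjective g)
    (hfg : ∀ x, f x = 0 → g x = 0) (x y : L) :
    killingForm K S (g x) (g y) = killingForm K S (f x) (f y) := by
  obtain ⟨s, hs⟩ := (f : L →ₗ[K] S).exists_rightInverse_of_surjective
    (LinearMap.range_eq_top.mpr hf)
  replace hs : ∀ z, f (s z) = z := fun z => LinearMap.congr_fun hs z
  have hgf : ∀ a b, f a = f b → g a = g b := fun a b h => by
    rw [← sub_eq_zero, ← map_sub]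
    exact hfg _ (by rw [map_sub, h, sub_self])
  let φ : S →ₗ⁅K⁆ S :=
    { (g : L →ₗ[K] S) ∘ₗ s with
      map_lie' := fun {z w} => by
        change g (s ⁅z, w⁆) = ⁅g (s z), g (s w)⁆
        rw [← LieHom.map_lie]
        exact hgf _ _ (by rw [LieHom.map_lie, hs, hs, hs]) }
  have hφ : ∀ a, φ (f a) = g a := fun a => hgf _ _ (hs _)
  have hsurj : Function.Surjective φ := fun z => by
    obtain ⟨a, rfl⟩ := hg z
    exact ⟨f a, hφ a⟩
  have hinj : Function.Injective φ :=
    (LinearMap.injective_iff_surjective (f := (φ : S →ₗ[K] S))).mpr hsurj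
  rw [← hφ, ← hφ]
  exact killingForm_of_equiv_apply (LieEquiv.ofBijective φ ⟨hinj, hsurj⟩) (f x) (f y)

/-- A bilinear form evaluated along two weakly continuous curves in a finite-dimensional space
is continuous. -/
theorem LinearMap.continuous_apply_apply_of_dual {X V : Type*} [TopologicalSpace X]
    [AddCommGroup V] [Module ℝ V] [FiniteDimensional ℝ V] (B : V →ₗ[ℝ] V →ₗ[ℝ] ℝ) (u v : X → V)
    (hu : ∀ ℓ : V →ₗ[ℝ] ℝ, Continuous fun t => ℓ (u t))
    (hv : ∀ ℓ : V →ₗ[ℝ] ℝ, Continuous fun t => ℓ (v t)) :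
    Continuous fun t => B (u t) (v t) := by
  let b := Module.finBasis ℝ V
  have h : ∀ t, B (u t) (v t) = ∑ i, b.coord i (v t) * B.flip (b i) (u t) := fun t => by
    conv_lhs => rw [← b.sum_repr (v t)]
    simp only [map_sum, map_smul, smul_eq_mul, Module.Basis.coord_apply, LinearMap.flip_apply]
  simp_rw [h]
  exact continuous_finsetSum _ fun i _ => (hv _).mul (hu _)

open LieAlgebra in
/-- A finite-dimensional real Lie algebra whose identity can be joined to zero by a weakly
continuous family of endomorphisms is solvable. -/
theorem LieAlgebra.isSolvable_of_contraction {L : Type*} [LieRing L] [LieAlgebra ℝ L]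
    [FiniteDimensional ℝ L] (θ : ℝ → L →ₗ⁅ℝ⁆ L)
    (hθ : ∀ (ℓ : L →ₗ[ℝ] ℝ) (x : L), Continuous fun t => ℓ (θ t x))
    (h0 : ∀ x, θ 0 x = x) (h1 : ∀ x, θ 1 x = 0) : IsSolvable L := by
  let S := L ⧸ radical ℝ L
  have : HasTrivialRadical ℝ S := hasTrivialRadical_quotient_radical
  have : FiniteDimensional ℝ S :=
    inferInstanceAs (FiniteDimensional ℝ (L ⧸ (radical ℝ L).toSubmodule))
  let f : L →ₗ⁅ℝ⁆ S := (radical ℝ L).quotientMk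
  have hf : Function.Surjective f := (radical ℝ L).quotientMk_surjective
  have hf0 : ∀ x, f x = 0 ↔ x ∈ radical ℝ L := (radical ℝ L).quotientMk_eq_zero
  let g : ℝ → L →ₗ⁅ℝ⁆ S := fun t => f.comp (θ t)
  have hg : ∀ (ℓ : S →ₗ[ℝ] ℝ) (x : L), Continuous fun t => ℓ (g t x) :=
    fun ℓ x => hθ (ℓ ∘ₗ (f : L →ₗ[ℝ] S)) x
  have hkill : ∀ t, Function.Surjective (g t) → ∀ x, f x = 0 → g t x = 0 :=
    fun t ht x hx => (g t).apply_eq_zero_of_mem_radical ht ((hf0 x).mp hx)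
  obtain ⟨s, hs⟩ := (f : L →ₗ[ℝ] S).exists_rightInverse_of_surjective
    (LinearMap.range_eq_top.mpr hf)
  replace hs : ∀ z, f (s z) = z := fun z => LinearMap.congr_fun hs z
  let T : Set ℝ := {t | Function.Surjective (g t)}
  have hdet : T = {t | LinearMap.det ((g t : L →ₗ[ℝ] S) ∘ₗ s) ≠ 0} := by
    ext t
    simp only [T, Set.mem_ofPred_eq]
    rw [← isUnit_iff_ne_zero, ← LinearMap.isUnit_iff_isUnit_det, LinearMap.isUnit_iff_range_eq_top,
      LinearMap.range_eq_top]
    refine ⟨fun ht z => ?_, fun ht z => ?_⟩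
    · obtain ⟨x, rfl⟩ := ht z
      refine ⟨f x, ?_⟩
      change g t (s (f x)) = g t x
      rw [← sub_eq_zero, ← map_sub]
      exact hkill t ht _ (by rw [map_sub, hs, sub_self])
    · obtain ⟨w, hw⟩ := ht z
      exact ⟨s w, hw⟩
  have hopen : IsOpen T := by
    rw [hdet]
    refine isOpen_ne_fun ?_ continuous_const
    let b := Module.finBasis ℝ S
    simp_rw [← LinearMap.det_toMatrix b]
    refine Continuous.matrix_det (continuous_matrix fun i j => ?_)
    simp_rw [LinearMap.toMatrix_apply]
    exact hg (b.coord i) (s (b j))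
  have hform : T = {t | ∀ x y, killingForm ℝ S (g t x) (g t y) = killingForm ℝ S (f x) (f y)} := by
    ext t
    refine ⟨fun ht => f.killingForm_apply_eq_of_ker_le (g t) hf ht (hkill t ht), fun ht => ?_⟩
    have hinj : Function.Injective ((g t : L →ₗ[ℝ] S) ∘ₗ s) := by
      rw [injective_iff_map_eq_zero]
      intro z hz
      refine (IsKilling.killingForm_nondegenerate ℝ S).1 z fun w => ?_
      have h := ht (s z) (s w)
      rw [hs, hs] at h
      rw [← h, show g t (s z) = 0 from hz, map_zero, LinearMap.zero_apply]
    intro z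
    obtain ⟨w, hw⟩ := LinearMap.surjective_of_injective hinj z
    exact ⟨s w, hw⟩
  have hclosed : IsClosed T := by
    rw [hform]
    simp only [Set.ofPred_forall]
    exact isClosed_iInter fun x => isClosed_iInter fun y => isClosed_eq
      (LinearMap.continuous_apply_apply_of_dual _ _ _ (fun ℓ => hg ℓ x) (fun ℓ => hg ℓ y))
      continuous_const
  have hT0 : (0 : ℝ) ∈ T := fun z => by
    obtain ⟨x, rfl⟩ := hf z
    exact ⟨x, congrArg f (h0 x)⟩
  have hT1 : (1 : ℝ) ∈ T := by
    rw [IsClopen.eq_univ ⟨hclosed, hopen⟩ ⟨0, hT0⟩]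
    trivial
  have hrad : radical ℝ L = ⊤ := by
    rw [eq_top_iff]
    intro x _
    rw [← hf0]
    obtain ⟨y, hy⟩ := hT1 (f x)
    rw [← hy]
    change f (θ 1 y) = 0
    rw [h1, map_zero]
  have hsol : IsSolvable (⊤ : LieIdeal ℝ L) := (LieIdeal.solvable_iff_le_radical ℝ L ⊤).mpr hrad.ge
  rwa [← solvable_iff_equiv_solvable LieSubalgebra.topEquiv (R := ℝ)]


/-- Every finite-dimensional real Lie algebra (encoded as a
finite-dimensional real normed space `L` with a bilinear bracket `br` satisfying
`br x x = 0` and the Jacobi identity) that is Lie contractible is solvable: its derived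
series `D 0 = ⊤`, `D (j+1) = span {br x y : x, y ∈ D j}` reaches `⊥` in finitely many
steps. -/
theorem solvable_of_lieContractible
    {L : Type*} [NormedAddCommGroup L] [NormedSpace ℝ L] [FiniteDimensional ℝ L]
    (br : L →ₗ[ℝ] L →ₗ[ℝ] L)
    (hskew : ∀ x : L, br x x = 0)
    (hjacobi : ∀ x y z : L, br x (br y z) = br (br x y) z + br y (br x z))
    (hcontr : ∃ θ : ℝ → (L →ₗ[ℝ] L),
      (∀ (t : ℝ) (x y : L), θ t (br x y) = br (θ t x) (θ t y)) ∧
      (∀ t : ℝ, t ≤ 0 → θ t = LinearMap.id) ∧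
      (∀ t : ℝ, 1 ≤ t → θ t = 0) ∧
      ContDiff ℝ (⊤ : ℕ∞) fun p : ℝ × L => θ p.1 p.2) :
    ∀ D : ℕ → Submodule ℝ L, D 0 = ⊤ →
      (∀ j : ℕ, D (j + 1) =
        Submodule.span ℝ {z : L | ∃ x ∈ D j, ∃ y ∈ D j, z = br x y}) →
      ∃ m : ℕ, D m = ⊥ := by
  intro D hD0 hD
  obtain ⟨θ, hθbr, hθ0, hθ1, hsmooth⟩ := hcontr
  let : LieRing L :=
    { bracket := fun x y => br x y
      add_lie := fun x y z => by simp
      lie_add := fun x y z => by simp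
      lie_self := hskew
      leibniz_lie := hjacobi }
  let : LieAlgebra ℝ L := { lie_smul := fun c x y => map_smul (br x) c y }
  let Θ : ℝ → L →ₗ⁅ℝ⁆ L := fun t => { θ t with map_lie' := fun {x y} => hθbr t x y }
  have hcont : ∀ (ℓ : L →ₗ[ℝ] ℝ) (x : L), Continuous fun t => ℓ (Θ t x) := fun ℓ x =>
    (LinearMap.continuous_of_finiteDimensional ℓ).comp
      (hsmooth.continuous.comp (Continuous.prodMk_left x))
  have hsol : LieAlgebra.IsSolvable L := LieAlgebra.isSolvable_of_contraction Θ hcont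
    (fun x => LinearMap.congr_fun (hθ0 0 le_rfl) x) (fun x => LinearMap.congr_fun (hθ1 1 le_rfl) x)
  obtain ⟨m, hm⟩ := LieAlgebra.IsSolvable.solvable ℝ L
  have hle : ∀ j, D j ≤ (LieAlgebra.derivedSeries ℝ L j).toSubmodule := by
    intro j
    induction j with
    | zero => exact fun x _ => LieSubmodule.mem_top x
    | succ j ih =>
      rw [hD, Submodule.span_le]
      rintro _ ⟨x, hx, y, hy, rfl⟩
      rw [LieAlgebra.derivedSeries_def, LieAlgebra.derivedSeriesOfIdeal_succ]
      exact LieSubmodule.lie_mem_lie (ih hx) (ih hy)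
  refine ⟨m, eq_bot_iff.mpr ((hle m).trans ?_)⟩
  rw [hm]
  exact le_rfl
end
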